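/- Let T on H²(𝔻) be defined by T(1) = T(z) = 1/2 and T(z^m) = z^{m+1} for m ≥ 2. Then T is a contraction with dim D_T = 2 and D_T = span{1, z}, and dim D_{T*} = 3 with D_{T*} = span{1, z, z²}; in particular D_T ⊆ D_{T*}. -/

import Mathlib

open ContinuousLinearMap

theorem aux_ext {H : Type*} [NormedAddCommGroup H] [InnerProductSpace ℂ H] [CompleteSpace H]
    (e : HilbertBasis ℕ ℂ H) (x y : H) (h : ∀ i, inner ℂ (e i) x = inner ℂ (e i) y) : x = y := by
  apply e.repr.injective
  ext i
  rw [e.repr_apply_apply, e.repr_apply_apply, h]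

theorem aux_sq {H : Type*} [NormedAddCommGroup H] [InnerProductSpace ℂ H] [CompleteSpace H]
    (D A : H →L[ℂ] H) (hD : D.IsPositive) (hA : D * D = A) (x : H) :
    inner ℂ (D x) (D x) = inner ℂ x (A x) := by
  rw [← hA]
  exact hD.isSymmetric x (D x)

theorem aux_range {H : Type*} [NormedAddCommGroup H] [InnerProductSpace ℂ H] [CompleteSpace H]
    (e : HilbertBasis ℕ ℂ H) (D A : H →L[ℂ] H) (hD : D.IsPositive) (hA : D * D = A)
    (S : Finset ℕ) (h0 : ∀ m, m ∉ S → A (e m) = 0) (h1 : ∀ m ∈ S, ∃ x, A x = e m) :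
    closure (Set.range D) = (Submodule.span ℂ (e '' (S : Set ℕ)) : Set H) := by
  apply Set.Subset.antisymm
  · have : FiniteDimensional ℂ (Submodule.span ℂ (e '' (S : Set ℕ))) :=
      FiniteDimensional.span_of_finite ℂ (S.finite_toSet.image _)
    refine closure_minimal ?_ (Submodule.closed_of_finiteDimensional _)
    rintro _ ⟨x, rfl⟩
    have hz : ∀ m ∉ S, e.repr (D x) m • e m = 0 := by
      intro m hm
      have : D (e m) = 0 := by
        rw [← inner_self_eq_zero (𝕜 := ℂ), aux_sq D A hD hA, h0 m hm, inner_zero_right]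
      have h2 : inner ℂ (D (e m)) x = inner ℂ (e m) (D x) := hD.isSymmetric (e m) x
      rw [e.repr_apply_apply, ← h2, this, inner_zero_left, zero_smul]
    rw [(e.hasSum_repr (D x)).unique (hasSum_sum_of_ne_finset_zero hz)]
    exact Submodule.sum_mem _ fun i hi =>
      Submodule.smul_mem _ _ (Submodule.subset_span ⟨i, hi, rfl⟩)
  · refine Set.Subset.trans ?_ subset_closure
    have : Submodule.span ℂ (e '' (S : Set ℕ)) ≤ LinearMap.range (D : H →ₗ[ℂ] H) := by
      rw [Submodule.span_le]
      rintro _ ⟨i, hi, rfl⟩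
      obtain ⟨x, hx⟩ := h1 i hi
      exact ⟨D x, by rw [← hx, ← hA]; rfl⟩
    intro y hy
    exact this hy

theorem aux_rank {H : Type*} [NormedAddCommGroup H] [InnerProductSpace ℂ H] [CompleteSpace H]
    (e : HilbertBasis ℕ ℂ H) (S : Finset ℕ) :
    Module.finrank ℂ (Submodule.span ℂ (e '' (S : Set ℕ))) = S.card := by
  have hl : LinearIndependent ℂ (fun i : S => e i) :=
    e.orthonormal.linearIndependent.comp _ Subtype.val_injective
  have := finrank_span_eq_card hl
  rw [Fintype.card_coe] at this
  rw [← this]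
  have hs : e '' (S : Set ℕ) = Set.range (fun i : S => e i) := by
    ext y
    simp
  rw [hs]

/-- For `T 1 = T z = 1/2`, `T z^m = z^{m+1}` (`m ≥ 2`): `T` is a contraction with
`D_T = span{1, z}` (dimension 2) and `D_{T*} = span{1, z, z²}` (dimension 3); in
particular `D_T ⊆ D_{T*}`. -/
theorem counterexample_defect_spaces
    {H : Type*} [NormedAddCommGroup H] [InnerProductSpace ℂ H] [CompleteSpace H]
    (e : HilbertBasis ℕ ℂ H) (T DT DTs : H →L[ℂ] H)
    (hT0 : T (e 0) = (1 / 2 : ℂ) • e 0) (hT1 : T (e 1) = (1 / 2 : ℂ) • e 0)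
    (hTm : ∀ m : ℕ, 2 ≤ m → T (e m) = e (m + 1))
    (hDTpos : DT.IsPositive) (hDT : DT * DT = 1 - adjoint T * T)
    (hDTspos : DTs.IsPositive) (hDTs : DTs * DTs = 1 - T * adjoint T) :
    ‖T‖ ≤ 1 ∧
      closure (Set.range DT) = (Submodule.span ℂ ({e 0, e 1} : Set H) : Set H) ∧
      Module.finrank ℂ (Submodule.span ℂ ({e 0, e 1} : Set H)) = 2 ∧
      closure (Set.range DTs) = (Submodule.span ℂ ({e 0, e 1, e 2} : Set H) : Set H) ∧
      Module.finrank ℂ (Submodule.span ℂ ({e 0, e 1, e 2} : Set H)) = 3 ∧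
      closure (Set.range DT) ⊆ closure (Set.range DTs) := by
  have ho : ∀ i j, inner ℂ (e i) (e j) = if i = j then (1 : ℂ) else 0 :=
    orthonormal_iff_ite.mp e.orthonormal
  have hc : ∀ i, i = 0 ∨ i = 1 ∨ 2 ≤ i := by intro i; omega
  have hcj : (starRingEnd ℂ) (1 / 2 : ℂ) = 1 / 2 := by
    rw [map_div₀, map_one, map_ofNat]
  have a0 : adjoint T (e 0) = (1 / 2 : ℂ) • (e 0 + e 1) := by
    apply aux_ext e
    intro i
    rw [adjoint_inner_right]
    rcases hc i with rfl | rfl | h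
    · simp only [hT0, ho, inner_smul_left, inner_smul_right, inner_add_right, hcj]
      norm_num
    · simp only [hT1, ho, inner_smul_left, inner_smul_right, inner_add_right, hcj]
      norm_num
    · have h1 : i ≠ 0 := by omega
      have h2 : i ≠ 1 := by omega
      simp [hTm i h, ho, h1, h2]
  have a12 : ∀ j, j = 1 ∨ j = 2 → adjoint T (e j) = 0 := by
    intro j hj
    apply aux_ext e
    intro i
    rw [adjoint_inner_right]
    have h0 : (0 : ℕ) ≠ j := by omega
    rcases hc i with rfl | rfl | h
    · simp [hT0, ho, inner_smul_left, h0]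
    · simp [hT1, ho, inner_smul_left, h0]
    · have h1 : i + 1 ≠ j := by omega
      simp [hTm i h, ho, h1]
  have am : ∀ m, 2 ≤ m → adjoint T (e (m + 1)) = e m := by
    intro j hj
    apply aux_ext e
    intro i
    rw [adjoint_inner_right]
    have h0 : (0 : ℕ) ≠ j := by omega
    have h1 : (1 : ℕ) ≠ j := by omega
    rcases hc i with rfl | rfl | h
    · simp [hT0, ho, inner_smul_left, h0]
    · simp [hT1, ho, inner_smul_left, h1]
    · simp [hTm i h, ho]
  have s2 : ({e 0, e 1} : Set H) = e '' (({0, 1} : Finset ℕ) : Set ℕ) := by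
    simp [Set.image_insert_eq]
  have s3 : ({e 0, e 1, e 2} : Set H) = e '' (({0, 1, 2} : Finset ℕ) : Set ℕ) := by
    simp [Set.image_insert_eq]
  have c1 : closure (Set.range DT) = (Submodule.span ℂ ({e 0, e 1} : Set H) : Set H) := by
    rw [s2]
    refine aux_range e DT _ hDTpos hDT _ ?_ ?_
    · intro m hm
      have h : 2 ≤ m := by
        simp at hm; omega
      simp [hTm m h, am m h]
    · intro m hm
      have hm' : m = 0 ∨ m = 1 := by simpa using hm
      rcases hm' with rfl | rfl
      · refine ⟨(3 / 2 : ℂ) • e 0 + (1 / 2 : ℂ) • e 1, ?_⟩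
        rw [sub_apply]
        change ((3 / 2 : ℂ) • e 0 + (1 / 2 : ℂ) • e 1) - (adjoint T) (T ((3 / 2 : ℂ) • e 0 + (1 / 2 : ℂ) • e 1)) = _
        simp only [map_add, map_smul, hT0, hT1, a0]
        module
      · refine ⟨(1 / 2 : ℂ) • e 0 + (3 / 2 : ℂ) • e 1, ?_⟩
        rw [sub_apply]
        change ((1 / 2 : ℂ) • e 0 + (3 / 2 : ℂ) • e 1) - (adjoint T) (T ((1 / 2 : ℂ) • e 0 + (3 / 2 : ℂ) • e 1)) = _
        simp only [map_add, map_smul, hT0, hT1, a0]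
        module
  have c2 : closure (Set.range DTs) = (Submodule.span ℂ ({e 0, e 1, e 2} : Set H) : Set H) := by
    rw [s3]
    refine aux_range e DTs _ hDTspos hDTs _ ?_ ?_
    · intro m hm
      obtain ⟨k, rfl⟩ : ∃ k, m = k + 1 := ⟨m - 1, by simp at hm; omega⟩
      have h : 2 ≤ k := by
        simp at hm; omega
      simp [hTm k h, am k h]
    · intro m hm
      have hm' : m = 0 ∨ m = 1 ∨ m = 2 := by simpa using hm
      rcases hm' with rfl | h
      · refine ⟨(2 : ℂ) • e 0, ?_⟩
        rw [sub_apply]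
        change ((2 : ℂ) • e 0) - T ((adjoint T) ((2 : ℂ) • e 0)) = _
        simp only [map_add, map_smul, hT0, hT1, a0]
        module
      · exact ⟨e m, by simp [a12 m h]⟩
  refine ⟨?_, c1, ?_, c2, ?_, ?_⟩
  · refine opNorm_le_bound _ zero_le_one fun x => ?_
    have h := aux_sq DT _ hDTpos hDT x
    have h2 : inner ℂ x ((1 - adjoint T * T) x) = inner ℂ x x - inner ℂ (T x) (T x) := by
      rw [← adjoint_inner_right, ← inner_sub_right]; rfl
    rw [h2] at h
    simp only [inner_self_eq_norm_sq_to_K] at h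
    have h3 : ‖DT x‖ ^ 2 = ‖x‖ ^ 2 - ‖T x‖ ^ 2 := by exact_mod_cast h
    rw [one_mul]
    exact le_of_sq_le_sq (by nlinarith [sq_nonneg ‖DT x‖]) (norm_nonneg _)
  · rw [s2, aux_rank]; rfl
  · rw [s3, aux_rank]; rfl
  · rw [c1, c2]
    apply Submodule.span_mono
    intro y hy
    rcases hy with rfl | rfl <;> simp
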